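/- Let U ⊂ ℝᵏ and V ⊂ ℝˡ be open neighborhoods of the origins, and f: U × V → ℝ a smooth function such that f⁻¹(0) = U × {0} equals the set of critical points of f, and at each point (u,0) the Hessian of f in the V-direction, H(f,u) = (∂²f/∂v_i∂v_j (u,0)), is non-degenerate. Then there exist smaller neighborhoods Û ⊂ U, V̂ ⊂ V of the origins and a smooth embedding h: Û × V̂ → U × V of the form h(u,v) = (u, g(u,v)) for some smooth g: Û × V̂ → V, and an integer λ with 0 ≤ λ ≤ l, such that f(h(u, v₁,…,v_l)) = −v₁² − ⋯ − v_λ² + v_{λ+1}² + ⋯ + v_l². -/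

import Mathlib

open scoped Topology ContDiff
open Filter

universe u

theorem exists_lt_iff_of_monotone_pred {l : ℕ} (p : Fin l → Prop) (hp : ∀ i j, i ≤ j → p i → p j) :
    ∃ m ≤ l, ∀ i : Fin l, (i : ℕ) < m ↔ ¬ p i := by
  classical
  have hex : ∃ n, n = l ∨ ∃ h : n < l, p ⟨n, h⟩ := ⟨l, Or.inl rfl⟩
  refine ⟨Nat.find hex, Nat.find_min' hex (Or.inl rfl), fun i => ⟨fun hi hpi => ?_, fun hi => ?_⟩⟩
  · exact Nat.find_min hex hi (Or.inr ⟨i.2, hpi⟩)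
  · by_contra! hle
    rcases Nat.find_spec hex with h | ⟨h, hm⟩
    · have := i.2
      omega
    · exact hi (hp _ _ hle hm)

theorem exists_equiv_eq_signed_sum_sq {l : ℕ}
    (a : (Fin l → ℝ) →L[ℝ] (Fin l → ℝ) →L[ℝ] ℝ) (hsymm : ∀ v w, a v w = a w v)
    (hinj : Function.Injective a) :
    ∃ (L : (Fin l → ℝ) ≃L[ℝ] (Fin l → ℝ)) (m : ℕ), m ≤ l ∧
      ∀ v, a v v = ∑ i : Fin l, (if (i : ℕ) < m then (-1 : ℝ) else 1) * (L v i) ^ 2 := by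
  let b : LinearMap.BilinForm ℝ (Fin l → ℝ) :=
    LinearMap.mk₂ ℝ (fun v w => a v w) (by simp) (by simp) (by simp) (by simp)
  have hb : ∀ v w, b v w = a v w := fun v w => rfl
  let Q : QuadraticForm ℝ (Fin l → ℝ) := LinearMap.BilinMap.toQuadraticMap b
  have hQ : (QuadraticMap.associated (R := ℝ) Q).SeparatingLeft := by
    have : QuadraticMap.associated (R := ℝ) Q = b :=
      QuadraticMap.associated_left_inverse ℝ fun v w => hsymm v w
    rw [this]
    intro v hv
    apply hinj
    ext1 w
    simpa [hb] using hv w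
  obtain ⟨w, hw, ⟨e⟩⟩ := Q.equivalent_one_neg_one_weighted_sum_squared hQ
  let c : Fin l ≃ Fin (Module.finrank ℝ (Fin l → ℝ)) := finCongr (by simp)
  let σ : Fin l ≃ Fin (Module.finrank ℝ (Fin l → ℝ)) := (Tuple.sort (w ∘ c)).trans c
  have hσ : Monotone (w ∘ σ) := Tuple.monotone_sort (w ∘ c)
  obtain ⟨m, hm, hmi⟩ := exists_lt_iff_of_monotone_pred (fun i => w (σ i) = 1) (fun i j hij hi => by
    have h1 : w (σ i) ≤ w (σ j) := hσ hij
    rcases hw (σ j) with h | h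
    · linarith
    · exact h)
  refine ⟨(e.toLinearEquiv.trans (LinearEquiv.funCongrLeft ℝ ℝ σ)).toContinuousLinearEquiv,
    m, hm, fun v => ?_⟩
  have h1 : a v v = QuadraticMap.weightedSumSquares ℝ w (e v) := by
    rw [e.map_app]; rfl
  rw [h1, QuadraticMap.weightedSumSquares_apply, ← σ.sum_comp]
  refine Finset.sum_congr rfl fun i _ => ?_
  have h2 : w (σ i) = if (i : ℕ) < m then (-1 : ℝ) else 1 := by
    split_ifs with h
    · exact (hw _).resolve_right ((hmi i).1 h)
    · exact not_not.1 (mt (hmi i).2 h)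
  rw [h2, smul_eq_mul, ← sq]
  rfl

/-- A form near a nondegenerate symmetric bilinear form `a` is obtained from `a` by a linear
change of variables depending analytically on the form. -/
theorem exists_analytic_congruence {W : Type*} [NormedAddCommGroup W] [NormedSpace ℝ W]
    [CompleteSpace W] (a : W →L[ℝ] W →L[ℝ] ℝ) (hsymm : ∀ v w, a v w = a w v)
    (e : W ≃L[ℝ] (W →L[ℝ] ℝ)) (he : ∀ v, e v = a v) :
    ∃ S : (W →L[ℝ] W →L[ℝ] ℝ) → (W →L[ℝ] W), ContDiffAt ℝ ω S a ∧ S a = 1 ∧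
      ∀ᶠ b in 𝓝 a, (∀ v w, b v w = b w v) → ∀ v, b v v = a (S b v) (S b v) := by
  let sq : (W →L[ℝ] W) → (W →L[ℝ] W) := fun T => T * T
  have hsq : ContDiffAt ℝ ω sq 1 := by
    apply ContDiffAt.mul <;> exact contDiffAt_id
  have hsq' : HasFDerivAt sq ((ContinuousLinearEquiv.smulLeft (Units.mk0 (2 : ℝ) two_ne_zero) :
      (W →L[ℝ] W) ≃L[ℝ] (W →L[ℝ] W)) : (W →L[ℝ] W) →L[ℝ] (W →L[ℝ] W)) 1 := by
    have := (hasFDerivAt_id (𝕜 := ℝ) (1 : W →L[ℝ] W)).mul' (hasFDerivAt_id (1 : W →L[ℝ] W))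
    refine this.congr_fderiv ?_
    ext1 T
    change (1 : W →L[ℝ] W) * T + T * 1 = (2 : ℝ) • T
    rw [one_mul, mul_one, two_smul]
  let R := hsq.toOpenPartialHomeomorph sq hsq' (by simp)
  have hR1 : (1 : W →L[ℝ] W) ∈ R.source := hsq.mem_toOpenPartialHomeomorph_source hsq' (by simp)
  have hsq1 : sq 1 = 1 := one_mul 1
  have hRs : R.symm 1 = 1 := by
    have := R.left_inv hR1
    rwa [show R 1 = 1 from hsq1] at this
  have hRt : (1 : W →L[ℝ] W) ∈ R.target := by
    have := R.map_source hR1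
    rwa [show R 1 = 1 from hsq1] at this
  have hRd : ContDiffAt ℝ ω R.symm 1 := by
    refine R.contDiffAt_symm hRt (f₀' := ?_) ?_ ?_
    · exact ContinuousLinearEquiv.smulLeft (Units.mk0 (2 : ℝ) two_ne_zero)
    · rw [hRs]; exact hsq'
    · rw [hRs]; exact hsq
  let M : (W →L[ℝ] W →L[ℝ] ℝ) → (W →L[ℝ] W) := fun b => (e.symm : (W →L[ℝ] ℝ) →L[ℝ] W) ∘L b
  have hM : ContDiff ℝ ω M := by
    exact contDiff_const.clm_comp contDiff_id
  have hMa : M a = 1 := by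
    ext v
    simp [M, ← he]
  have haM : ∀ b v, a (M b v) = b v := fun b v => by simp [M, ← he]
  let adj : (W →L[ℝ] W) → (W →L[ℝ] W) := fun T =>
    (e.symm : (W →L[ℝ] ℝ) →L[ℝ] W) ∘L (((ContinuousLinearMap.compL ℝ W W ℝ).flip T) ∘L a)
  have hadj : Continuous adj := by
    fun_prop
  have ha_adj : ∀ T v w, a (adj T v) w = a v (T w) := fun T v w => by simp [adj, ← he]
  have hinj : ∀ v w, (∀ z, a v z = a w z) → v = w := fun v w h => e.injective (by
    ext z; simpa [he] using h z)
  have hadj1 : adj 1 = 1 := by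
    ext v
    exact hinj _ _ fun z => by simp [ha_adj]
  have hScont : ContinuousAt (fun b => R.symm (M b)) a := by
    refine ContinuousAt.comp (g := R.symm) ?_ hM.continuous.continuousAt
    rw [hMa]; exact hRd.continuousAt
  refine ⟨fun b => R.symm (M b), ?_, by simp only [hMa, hRs], ?_⟩
  · refine ContDiffAt.comp (g := R.symm) a ?_ hM.contDiffAt
    rw [hMa]; exact hRd
  have h1 : ∀ᶠ b in 𝓝 a, M b ∈ R.target :=
    hM.continuous.continuousAt.eventually_mem (by rw [hMa]; exact R.open_target.mem_nhds hRt)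
  have h2 : ∀ᶠ b in 𝓝 a, adj (R.symm (M b)) ∈ R.source := by
    have : ContinuousAt (fun b => adj (R.symm (M b))) a := hadj.continuousAt.comp hScont
    refine this.eventually_mem ?_
    rw [hMa, hRs, hadj1]
    exact R.open_source.mem_nhds hR1
  filter_upwards [h1, h2] with b hb1 hb2 hbs v
  set B := R.symm (M b) with hB
  have hBB : ∀ v, B (B v) = M b v := fun v => congrArg (fun T : W →L[ℝ] W => T v) (R.right_inv hb1)
  have hBa : adj B = B := by
    refine R.injOn hb2 (R.map_target hb1) ?_
    rw [R.right_inv hb1]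
    ext v
    refine hinj _ _ fun z => ?_
    change a (adj B (adj B v)) z = _
    rw [ha_adj, ha_adj, hBB, haM, hsymm, haM, hbs]
  rw [← haM, ← hBB, ← ha_adj, hBa]
theorem hasFDerivAt_intervalIntegral_of_contDiff {E F : Type*} [NormedAddCommGroup E]
    [NormedSpace ℝ E] [ProperSpace E] [NormedAddCommGroup F] [NormedSpace ℝ F] {a b : ℝ}
    {φ : E → ℝ → F} (hφ : ContDiff ℝ 1 (Function.uncurry φ)) (x : E) :
    HasFDerivAt (fun x => ∫ t in a..b, φ x t)
      (∫ t in a..b, fderiv ℝ (Function.uncurry φ) (x, t) ∘L ContinuousLinearMap.inl ℝ E ℝ) x := by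
  have hc : Continuous fun p : E × ℝ =>
      fderiv ℝ (Function.uncurry φ) p ∘L ContinuousLinearMap.inl ℝ E ℝ :=
    (hφ.continuous_fderiv (by simp)).clm_comp continuous_const
  have hφx : ∀ x, Continuous (φ x) := fun x =>
    hφ.continuous.comp (continuous_const.prodMk continuous_id)
  have hcx : Continuous fun t : ℝ =>
      fderiv ℝ (Function.uncurry φ) (x, t) ∘L ContinuousLinearMap.inl ℝ E ℝ :=
    hc.comp (continuous_const.prodMk continuous_id)
  obtain ⟨C, hC⟩ := ((isCompact_closedBall x 1).prod (isCompact_uIcc (a := a) (b := b))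
    ).exists_bound_of_continuousOn hc.continuousOn
  refine intervalIntegral.hasFDerivAt_integral_of_dominated_of_fderiv_le
    (F' := fun x t => fderiv ℝ (Function.uncurry φ) (x, t) ∘L ContinuousLinearMap.inl ℝ E ℝ)
    (bound := fun _ => C) (Metric.closedBall_mem_nhds x one_pos)
    (Eventually.of_forall fun y => (hφx y).aestronglyMeasurable) ((hφx x).intervalIntegrable _ _)
    hcx.aestronglyMeasurable
    (Eventually.of_forall fun t ht y hy => hC (y, t) ⟨hy, Set.uIoc_subset_uIcc ht⟩)
    intervalIntegrable_const (Eventually.of_forall fun t _ y _ => ?_)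
  have h1 := ((hφ.differentiable (by simp)) (y, t)).hasFDerivAt
  have h2 : HasFDerivAt (fun y : E => (y, t)) (ContinuousLinearMap.inl ℝ E ℝ) y :=
    hasFDerivAt_prodMk_left y t
  exact h1.comp y h2

theorem ContDiff.intervalIntegral_nat {E : Type u} [NormedAddCommGroup E] [NormedSpace ℝ E]
    [ProperSpace E] {a b : ℝ} (n : ℕ) {F : Type u} [NormedAddCommGroup F] [NormedSpace ℝ F]
    {φ : E → ℝ → F} (hφ : ContDiff ℝ ∞ (Function.uncurry φ)) :
    ContDiff ℝ n fun x => ∫ t in a..b, φ x t := by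
  have hd := hasFDerivAt_intervalIntegral_of_contDiff (a := a) (b := b)
    (hφ.of_le (by exact_mod_cast le_top))
  induction n generalizing F with
  | zero =>
    exact contDiff_zero.2 (continuous_iff_continuousAt.2 fun x => (hd x).continuousAt)
  | succ n ih =>
    rw [Nat.cast_add, Nat.cast_one, contDiff_succ_iff_hasFDerivAt]
    have hφ' : ContDiff ℝ ∞ (Function.uncurry fun x t =>
        fderiv ℝ (Function.uncurry φ) (x, t) ∘L ContinuousLinearMap.inl ℝ E ℝ) :=
      (hφ.fderiv_right (m := ∞) (by simp)).clm_comp contDiff_const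
    exact ⟨_, ih hφ' (hasFDerivAt_intervalIntegral_of_contDiff
      (hφ'.of_le (by exact_mod_cast le_top))), hd⟩

theorem ContDiffOn.exists_contDiff_eventuallyEq {E F : Type*} [NormedAddCommGroup E]
    [NormedSpace ℝ E] [HasContDiffBump E] [NormedAddCommGroup F] [NormedSpace ℝ F]
    {f : E → F} {s : Set E} {x : E} {n : ℕ∞} (hf : ContDiffOn ℝ n f s) (hs : s ∈ 𝓝 x) :
    ∃ g : E → F, ContDiff ℝ n g ∧ g =ᶠ[𝓝 x] f := by
  obtain ⟨r, hr, hrs⟩ := Metric.nhds_basis_closedBall.mem_iff.1 hs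
  let χ : ContDiffBump x := ⟨r / 3, r / 2, by positivity, by linarith⟩
  have hχ : tsupport χ ⊆ Metric.ball x r := by
    rw [χ.tsupport_eq]
    exact Metric.closedBall_subset_ball (by simp [χ]; linarith)
  refine ⟨fun y => χ y • f y, contDiff_iff_contDiffAt.2 fun y => ?_, ?_⟩
  · by_cases hy : y ∈ tsupport χ
    · exact χ.contDiff.contDiffAt.smul (hf.contDiffAt (Filter.mem_of_superset
        (Metric.isOpen_ball.mem_nhds (hχ hy)) (Metric.ball_subset_closedBall.trans hrs)))
    · refine (contDiffAt_const (c := (0 : F))).congr_of_eventuallyEq ?_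
      filter_upwards [notMem_tsupport_iff_eventuallyEq.1 hy] with z hz
      simp [hz]
  · filter_upwards [χ.eventuallyEq_one] with y hy
    simp [hy]

section
variable {P W : Type u} [NormedAddCommGroup P] [NormedSpace ℝ P] [ProperSpace P]
  [NormedAddCommGroup W] [NormedSpace ℝ W] [ProperSpace W]

/-- Second order Taylor expansion in the second variable, with smooth remainder. -/
theorem exists_contDiff_taylor_two_snd {f : P × W → ℝ} (hf : ContDiff ℝ ∞ f) :
    ∃ A : P × W → W →L[ℝ] W →L[ℝ] ℝ, ContDiff ℝ ∞ A ∧ (∀ x v w, A x v w = A x w v) ∧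
      (∀ u v, f (u, v) = f (u, 0) + fderiv ℝ f (u, 0) (0, v) + A (u, v) v v) ∧
      ∀ u v w, A (u, 0) v w = 2⁻¹ * fderiv ℝ (fderiv ℝ f) (u, 0) (0, v) (0, w) := by
  let ι : W →L[ℝ] P × W := ContinuousLinearMap.inr ℝ P W
  let G : P × W → W →L[ℝ] W →L[ℝ] ℝ := fun x =>
    ((ContinuousLinearMap.compL ℝ W (P × W) ℝ).flip ι) ∘L (fderiv ℝ (fderiv ℝ f) x ∘L ι)
  have hf1 : ContDiff ℝ ∞ (fderiv ℝ f) := hf.fderiv_right (by simp)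
  have hf2 : ContDiff ℝ ∞ (fderiv ℝ (fderiv ℝ f)) := hf1.fderiv_right (by simp)
  have hG : ContDiff ℝ ∞ G := contDiff_const.clm_comp (hf2.clm_comp contDiff_const)
  have hGa : ∀ x v w, G x v w = fderiv ℝ (fderiv ℝ f) x (0, v) (0, w) := fun x v w => rfl
  have hGs : ∀ x v w, G x v w = G x w v := fun x v w =>
    (hf.contDiffAt.isSymmSndFDerivAt (by
      simp only [minSmoothness_of_isRCLikeNormedField]
      exact WithTop.coe_le_coe.2 le_top)) _ _
  let φ : P × W → ℝ → W →L[ℝ] W →L[ℝ] ℝ := fun x t => (1 - t) • G (x.1, t • x.2)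
  have hφ : ContDiff ℝ ∞ (Function.uncurry φ) := by
    have h1 : ContDiff ℝ ∞ fun p : (P × W) × ℝ => 1 - p.2 := by fun_prop
    have h2 : ContDiff ℝ ∞ fun p : (P × W) × ℝ => (p.1.1, p.2 • p.1.2) := by fun_prop
    have h3 : ∀ {F : Type u} [NormedAddCommGroup F] [NormedSpace ℝ F] {c : (P × W) × ℝ → ℝ}
        {g : (P × W) × ℝ → F}, ContDiff ℝ ∞ c → ContDiff ℝ ∞ g →
        ContDiff ℝ ∞ fun p => c p • g p := fun hc hg => hc.smul hg
    exact h3 h1 (hG.comp h2)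
  have hφx : ∀ x, Continuous (φ x) := fun x =>
    hφ.continuous.comp (continuous_const.prodMk continuous_id)
  have hint : ∀ x v w, (∫ t in (0 : ℝ)..1, φ x t) v w = ∫ t in (0 : ℝ)..1, φ x t v w := by
    intro x v w
    rw [ContinuousLinearMap.intervalIntegral_apply ((hφx x).intervalIntegrable _ _),
      ContinuousLinearMap.intervalIntegral_apply]
    exact ((hφx x).clm_apply continuous_const).intervalIntegrable _ _
  refine ⟨fun x => ∫ t in (0 : ℝ)..1, φ x t, ?_, ?_, ?_, ?_⟩
  · exact contDiff_infty.2 fun n => hφ.intervalIntegral_nat n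
  · intro x v w
    rw [hint, hint]
    congr 1
    ext t
    simp [φ, hGs _ v w]
  · intro u v
    rw [hint]
    have hγ : ∀ t : ℝ, HasDerivAt (fun t : ℝ => ((u, t • v) : P × W)) (0, v) t := fun t => by
      simpa using (hasDerivAt_const t u).prodMk ((hasDerivAt_id t).smul_const v)
    have h1 : ∀ t : ℝ, HasDerivAt (fun t : ℝ => f (u, t • v)) (fderiv ℝ f (u, t • v) (0, v)) t :=
      fun t => ((hf.differentiable (by simp)) _).hasFDerivAt.comp_hasDerivAt t (hγ t)
    have h2 : ∀ t : ℝ, HasDerivAt (fun t : ℝ => fderiv ℝ f (u, t • v) (0, v))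
        (G (u, t • v) v v) t := fun t => by
      have := (((hf1.differentiable (by simp)) _).hasFDerivAt.comp_hasDerivAt t (hγ t)).clm_apply
        (hasDerivAt_const t ((0, v) : P × W))
      simpa [hGa] using this
    have h3 : ∀ t : ℝ, HasDerivAt
        (fun t : ℝ => (1 - t) * fderiv ℝ f (u, t • v) (0, v) + f (u, t • v)) (φ (u, v) t v v) t := by
      intro t
      refine ((((hasDerivAt_id t).const_sub 1).mul (h2 t)).add (h1 t)).congr_deriv ?_
      simp [φ]
    rw [intervalIntegral.integral_eq_sub_of_hasDerivAt (fun t _ => h3 t)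
      ((((hφx _).clm_apply continuous_const).clm_apply continuous_const).intervalIntegrable _ _)]
    simp only [sub_self, zero_mul, one_smul, zero_add, sub_zero, one_mul, zero_smul]
    ring
  · intro u v w
    rw [hint, ← hGa]
    simp only [φ, smul_zero, smul_apply, smul_eq_mul, intervalIntegral.integral_mul_const]
    rw [intervalIntegral.integral_sub (by simp) (by simp)]
    norm_num
end

/-- Near a point where the derivative of a smooth map is invertible, the map has a smooth local
inverse, defined on a whole neighbourhood. -/
theorem exists_openPartialHomeomorph_contDiffAt_symm {E F : Type*} [NormedAddCommGroup E]
    [NormedSpace ℝ E] [CompleteSpace E] [NormedAddCommGroup F] [NormedSpace ℝ F] {f : E → F}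
    {x : E} (hf : ∀ᶠ y in 𝓝 x, ContDiffAt ℝ ∞ f y) (f' : E ≃L[ℝ] F)
    (hf' : HasFDerivAt f (f' : E →L[ℝ] F) x) :
    ∃ R : OpenPartialHomeomorph E F, (R : E → F) = f ∧ x ∈ R.source ∧
      ∀ᶠ z in 𝓝 (f x), ContDiffAt ℝ ∞ R.symm z := by
  have hfx := hf.self_of_nhds
  let R := hfx.toOpenPartialHomeomorph f hf' (by simp)
  have hx : x ∈ R.source := hfx.mem_toOpenPartialHomeomorph_source hf' (by simp)
  have hRf : (R : E → F) = f := rfl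
  have hinv : ∀ᶠ y in 𝓝 x, ∃ e : E ≃L[ℝ] F, (e : E →L[ℝ] F) = fderiv ℝ f y := by
    have h : Set.range ((↑) : (E ≃L[ℝ] F) → E →L[ℝ] F) ∈ 𝓝 (fderiv ℝ f x) := by
      rw [hf'.fderiv]
      exact f'.nhds
    exact (hfx.fderiv_right (m := 0) (by simp)).continuousAt.eventually_mem h
  have hall : ∀ᶠ y in 𝓝 x, ContDiffAt ℝ ∞ f y ∧ ∃ e : E ≃L[ℝ] F, (e : E →L[ℝ] F) = fderiv ℝ f y :=
    hf.and hinv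
  have ht : f x ∈ R.target := R.map_source hx
  have hsx : R.symm (f x) = x := R.left_inv hx
  refine ⟨R, hRf, hx, ?_⟩
  have hc : Tendsto R.symm (𝓝 (f x)) (𝓝 x) := by
    simpa only [ContinuousAt, hsx] using R.continuousAt_symm ht
  filter_upwards [hc.eventually hall, R.open_target.mem_nhds ht] with z ⟨hz, e, he⟩ hzt
  refine R.contDiffAt_symm hzt (f₀' := e) ?_ hz
  rw [he]
  exact (hz.differentiableAt (by simp)).hasFDerivAt

theorem injective_of_det_ne_zero {l : ℕ} (a : (Fin l → ℝ) →L[ℝ] (Fin l → ℝ) →L[ℝ] ℝ)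
    (h : (Matrix.of fun i j => a (Pi.single i 1) (Pi.single j 1)).det ≠ 0) :
    Function.Injective a := by
  refine (injective_iff_map_eq_zero a).2 fun v hv => Matrix.eq_zero_of_vecMul_eq_zero h ?_
  ext j
  have : v = ∑ i, v i • (Pi.single i 1 : Fin l → ℝ) := by
    ext j
    simp [Finset.sum_apply, Pi.single_apply]
  have h2 : a v (Pi.single j 1) = 0 := by rw [hv]; rfl
  rw [this] at h2
  simpa [Matrix.vecMul, dotProduct] using h2


/-- (Fiberwise Morse lemma.)  Let `U ⊆ ℝᵏ`, `V ⊆ ℝˡ` be open neighbourhoods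
of the origins and `f : U × V → ℝ` smooth with `f⁻¹(0) = U × {0}` equal to the critical set
of `f`, such that at each `(u,0)` the Hessian of `f` in the `V`-direction is non-degenerate.
Then there are smaller neighbourhoods `Û, V̂` of the origins and a smooth embedding
`h(u,v) = (u, g(u,v))` preserving the first coordinate, and `0 ≤ λ ≤ l`, with
`f(h(u,v)) = -v₁² - ⋯ - v_λ² + v_{λ+1}² + ⋯ + v_l²`. -/
theorem stmt_7 {k l : ℕ}
    (U : Set (Fin k → ℝ)) (V : Set (Fin l → ℝ)) (hU : IsOpen U) (hV : IsOpen V)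
    (hU0 : (0 : Fin k → ℝ) ∈ U) (hV0 : (0 : Fin l → ℝ) ∈ V)
    (f : (Fin k → ℝ) × (Fin l → ℝ) → ℝ)
    (hf : ContDiffOn ℝ (⊤ : ℕ∞) f (U ×ˢ V))
    (hzero : ∀ x ∈ U ×ˢ V, (f x = 0 ↔ x.2 = 0))
    (hcrit : ∀ x ∈ U ×ˢ V, (fderiv ℝ f x = 0 ↔ x.2 = 0))
    (hhess : ∀ u ∈ U, (Matrix.of fun i j : Fin l =>
        fderiv ℝ (fun x => fderiv ℝ f x (0, Pi.single j 1)) (u, 0) (0, Pi.single i 1)).det ≠ 0) :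
    ∃ (U' : Set (Fin k → ℝ)) (V' : Set (Fin l → ℝ)), IsOpen U' ∧ IsOpen V' ∧
      (0 : Fin k → ℝ) ∈ U' ∧ (0 : Fin l → ℝ) ∈ V' ∧ U' ⊆ U ∧ V' ⊆ V ∧
      ∃ g : (Fin k → ℝ) × (Fin l → ℝ) → (Fin l → ℝ),
        ContDiffOn ℝ (⊤ : ℕ∞) g (U' ×ˢ V') ∧
        (∀ x ∈ U' ×ˢ V', (x.1, g x) ∈ U ×ˢ V) ∧
        Set.InjOn (fun x => (x.1, g x)) (U' ×ˢ V') ∧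
        ∃ lam : ℕ, lam ≤ l ∧
          ∀ x ∈ U' ×ˢ V', f (x.1, g x) =
            ∑ i : Fin l, (if (i : ℕ) < lam then (-1 : ℝ) else 1) * (x.2 i) ^ 2 := by
  have hUV : U ×ˢ V ∈ 𝓝 (0 : (Fin k → ℝ) × (Fin l → ℝ)) := (hU.prod hV).mem_nhds ⟨hU0, hV0⟩
  obtain ⟨F, hF, hFf⟩ := hf.exists_contDiff_eventuallyEq hUV
  obtain ⟨A, hA, hAs, hAF, hA0⟩ := exists_contDiff_taylor_two_snd hF
  have hinj : Function.Injective (A 0) := by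
    refine injective_of_det_ne_zero _ ?_
    have h : (Matrix.of fun i j : Fin l => A 0 (Pi.single i 1) (Pi.single j 1)) = (2⁻¹ : ℝ) •
        (Matrix.of fun i j : Fin l => fderiv ℝ (fun x => fderiv ℝ f x (0, Pi.single j 1))
          ((0 : Fin k → ℝ), (0 : Fin l → ℝ)) (0, Pi.single i 1)) := by
      ext i j
      have h1 : (fun x => fderiv ℝ f x (0, Pi.single j 1)) =ᶠ[𝓝 ((0 : Fin k → ℝ), (0 : Fin l → ℝ))]
          fun x => fderiv ℝ F x (0, Pi.single j 1) := by
        filter_upwards [hFf.fderiv (𝕜 := ℝ)] with x hx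
        rw [hx]
      have h2 := (((hF.fderiv_right (m := ∞) (by simp)).differentiable (by simp))
        ((0 : Fin k → ℝ), (0 : Fin l → ℝ))).hasFDerivAt.clm_apply
          (hasFDerivAt_const ((0 : Fin k → ℝ), (Pi.single j 1 : Fin l → ℝ)) _)
      have h3 := hA0 0 (Pi.single i 1) (Pi.single j 1)
      simp only [Matrix.of_apply, Matrix.smul_apply, h1.fderiv_eq, h2.fderiv, smul_eq_mul]
      rw [show (0 : (Fin k → ℝ) × (Fin l → ℝ)) = (0, 0) from rfl, h3]
      simp
    rw [h, Matrix.det_smul]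
    exact mul_ne_zero (by positivity) (hhess 0 hU0)
  let e : (Fin l → ℝ) ≃L[ℝ] ((Fin l → ℝ) →L[ℝ] ℝ) :=
    (LinearEquiv.ofInjectiveOfFinrankEq (A 0 : (Fin l → ℝ) →ₗ[ℝ] ((Fin l → ℝ) →L[ℝ] ℝ)) hinj
      (Subspace.dual_finrank_eq.symm.trans LinearMap.toContinuousLinearMap.finrank_eq)).toContinuousLinearEquiv
  obtain ⟨S, hS, hS1, hSA⟩ := exists_analytic_congruence (A 0) (hAs 0) e fun v => rfl
  obtain ⟨L, m, hm, hL⟩ := exists_equiv_eq_signed_sum_sq (A 0) (hAs 0) hinj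
  let B : (Fin k → ℝ) × (Fin l → ℝ) → (Fin l → ℝ) →L[ℝ] (Fin l → ℝ) := fun x => S (A x)
  have hB : ∀ᶠ x in 𝓝 0, ContDiffAt ℝ ∞ B x := by
    filter_upwards [hA.continuous.continuousAt.eventually (hS.eventually (by simp))] with x hx
    exact (hx.of_le le_top).comp x hA.contDiffAt
  let Φ : (Fin k → ℝ) × (Fin l → ℝ) → (Fin k → ℝ) × (Fin l → ℝ) := fun x => (x.1, L (B x x.2))
  have hΦ : ∀ᶠ x in 𝓝 0, ContDiffAt ℝ ∞ Φ x := by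
    filter_upwards [hB] with x hx
    exact contDiffAt_fst.prodMk (L.contDiff.contDiffAt.comp x (hx.clm_apply contDiffAt_snd))
  have hΦ0 : Φ 0 = 0 := by simp [Φ]
  have hΦ' : HasFDerivAt Φ (((ContinuousLinearEquiv.refl ℝ (Fin k → ℝ)).prodCongr L :
      ((Fin k → ℝ) × (Fin l → ℝ)) ≃L[ℝ] (Fin k → ℝ) × (Fin l → ℝ)) :
      ((Fin k → ℝ) × (Fin l → ℝ)) →L[ℝ] (Fin k → ℝ) × (Fin l → ℝ)) 0 := by
    have h1 := (hB.self_of_nhds.differentiableAt (by simp)).hasFDerivAt.clm_apply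
      (hasFDerivAt_snd (𝕜 := ℝ) (E := Fin k → ℝ) (F := Fin l → ℝ) (p := 0))
    refine (hasFDerivAt_fst.prodMk
      ((L : (Fin l → ℝ) →L[ℝ] (Fin l → ℝ)).hasFDerivAt.comp _ h1)).congr_fderiv ?_
    refine ContinuousLinearMap.ext fun x => ?_
    simp [B, hS1]
    rfl
  obtain ⟨R, hRΦ, hR0, hRs⟩ := exists_openPartialHomeomorph_contDiffAt_symm hΦ _ hΦ'
  rw [hΦ0] at hRs
  have ht : (0 : (Fin k → ℝ) × (Fin l → ℝ)) ∈ R.target := by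
    simpa [hRΦ, hΦ0] using R.map_source hR0
  have hsymm0 : R.symm 0 = 0 := by
    simpa [hRΦ, hΦ0] using R.left_inv hR0
  have hfst : ∀ y ∈ R.target, (y.1, (R.symm y).2) = R.symm y := by
    intro y hy
    have := congrArg Prod.fst (R.right_inv hy)
    rw [hRΦ] at this
    exact Prod.ext this.symm rfl
  have hform : ∀ᶠ x in 𝓝 (0 : (Fin k → ℝ) × (Fin l → ℝ)), x ∈ U ×ˢ V ∧
      f x = ∑ i : Fin l, (if (i : ℕ) < m then (-1 : ℝ) else 1) * ((Φ x).2 i) ^ 2 := by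
    have hp : Tendsto (fun x : (Fin k → ℝ) × (Fin l → ℝ) => (x.1, (0 : Fin l → ℝ))) (𝓝 0) (𝓝 0) :=
      Continuous.tendsto' (by fun_prop) _ _ rfl
    filter_upwards [hUV, hFf, hp.eventually hFf.eventuallyEq_nhds,
      hp.eventually (eventually_mem_set.2 hUV), hA.continuous.continuousAt.eventually hSA]
      with x hx hfx hfx0 hx0 hSx
    refine ⟨hx, ?_⟩
    rw [← hfx, ← hL, ← hSx (hAs x)]
    have := hAF x.1 x.2
    rw [hfx0.fderiv_eq, hfx0.self_of_nhds, (hzero _ hx0).2 rfl, (hcrit _ hx0).2 rfl] at this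
    simpa using this
  have hc : Tendsto R.symm (𝓝 0) (𝓝 0) := by
    simpa only [ContinuousAt, hsymm0] using R.continuousAt_symm ht
  have hev : ∀ᶠ y in 𝓝 (0 : (Fin k → ℝ) × (Fin l → ℝ)), y ∈ U ×ˢ V ∧ y ∈ R.target ∧
      ContDiffAt ℝ ∞ R.symm y ∧ R.symm y ∈ U ×ˢ V ∧
      f (R.symm y) = ∑ i : Fin l, (if (i : ℕ) < m then (-1 : ℝ) else 1) * (y.2 i) ^ 2 := by
    filter_upwards [hUV, R.open_target.mem_nhds ht, hRs, hc.eventually hform] with y h1 h2 h3 h4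
    refine ⟨h1, h2, h3, h4.1, ?_⟩
    rw [h4.2, ← hRΦ, R.right_inv h2]
  obtain ⟨U', V', hU', h0U', hV', h0V', hsub⟩ := mem_nhds_prod_iff'.1 hev
  refine ⟨U', V', hU', hV', h0U', h0V', fun u hu => (hsub (Set.mk_mem_prod hu h0V')).1.1,
    fun v hv => (hsub (Set.mk_mem_prod h0U' hv)).1.2, fun y => (R.symm y).2,
    fun y hy => ?_, fun y hy => ?_, fun y hy z hz hyz => ?_, m, hm, fun y hy => ?_⟩
  · exact (contDiffAt_snd.comp y (hsub hy).2.2.1).contDiffWithinAt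
  · rw [hfst y (hsub hy).2.1]
    exact (hsub hy).2.2.2.1
  · simp only [hfst y (hsub hy).2.1, hfst z (hsub hz).2.1] at hyz
    exact R.symm.injOn (hsub hy).2.1 (hsub hz).2.1 hyz
  · rw [hfst y (hsub hy).2.1]
    exact (hsub hy).2.2.2.2
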